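/- Let τ : [0,1] → [0,1] be the piecewise-linear map equal to α_i x + c_i on each interval A_i = [a_i, a_i'] (with α_i > 0 and τ(A_i) ⊆ A_i) for i = 1, …, n, and equal to the identity outside A := ∪_i A_i. Then for every finite signed Borel measure μ on [0,1] one has V(τ*μ) ≤ (n + 1 + Σ_{i=1}^n 1/α_i)·V(μ). -/

import Mathlib

open MeasureTheory Set

/-- Integral of a function against a finite signed Borel measure, via the Jordan
decomposition. -/
noncomputable def sInt (μ : SignedMeasure ℝ) (f : ℝ → ℝ) : ℝ :=
  (∫ x, f x ∂μ.toJordanDecomposition.posPart) - ∫ x, f x ∂μ.toJordanDecomposition.negPart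

/-- A signed measure on `ℝ` is concentrated on `[0,1]` (i.e. it is a finite signed Borel
measure on `[0,1]`). -/
def ConcOnUnit (μ : SignedMeasure ℝ) : Prop :=
  μ.toJordanDecomposition.posPart (Icc (0:ℝ) 1)ᶜ = 0 ∧
  μ.toJordanDecomposition.negPart (Icc (0:ℝ) 1)ᶜ = 0

/-- The variation `V(μ) = sup {∫ φ' dμ : φ ∈ C¹([0,1]), |φ| ≤ 1}`. -/
noncomputable def Vvar (μ : SignedMeasure ℝ) : ℝ :=
  sSup {y | ∃ φ : ℝ → ℝ, ContDiff ℝ 1 φ ∧ (∀ x ∈ Icc (0:ℝ) 1, |φ x| ≤ 1) ∧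
    y = sInt μ (deriv φ)}

/-- The boundary-vanishing variation
`V₀(μ) = sup {∫ φ' dμ : φ ∈ C¹([0,1]), |φ| ≤ 1, φ(0) = φ(1) = 0}`. -/
noncomputable def Vvar0 (μ : SignedMeasure ℝ) : ℝ :=
  sSup {y | ∃ φ : ℝ → ℝ, ContDiff ℝ 1 φ ∧ (∀ x ∈ Icc (0:ℝ) 1, |φ x| ≤ 1) ∧
    φ 0 = 0 ∧ φ 1 = 0 ∧ y = sInt μ (deriv φ)}

/-- The weak norm `‖μ‖ = sup {∫ φ dμ : φ bounded measurable, |φ| ≤ 1}` (the total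
variation norm). -/
noncomputable def weakNorm (μ : SignedMeasure ℝ) : ℝ :=
  sSup {y | ∃ φ : ℝ → ℝ, Measurable φ ∧ (∀ x, |φ x| ≤ 1) ∧ y = sInt μ φ}

/-- The piecewise-linear map of `[0,1]` equal to `α_i x + c_i` on each interval
`A_i = [a_i, a_i']` (with `α_i > 0` and `τ(A_i) ⊆ A_i`), and equal to the identity outside
`A = ∪_i A_i`. -/
structure PiecewiseLinearMap (n : ℕ) where
  npos : 0 < n
  /-- left endpoints of the intervals `A_i` -/
  a : Fin n → ℝ
  /-- right endpoints of the intervals `A_i` -/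
  a' : Fin n → ℝ
  /-- slopes -/
  slope : Fin n → ℝ
  /-- intercepts -/
  c : Fin n → ℝ
  ha0 : ∀ i, 0 ≤ a i
  ha1 : ∀ i, a' i ≤ 1
  hlt : ∀ i, a i < a' i
  hsep : ∀ i : Fin n, ∀ h : (i : ℕ) + 1 < n, a' i ≤ a ⟨(i : ℕ) + 1, h⟩
  slope_pos : ∀ i, 0 < slope i
  /-- the map itself -/
  toFun : ℝ → ℝ
  eqA : ∀ i, ∀ x ∈ Set.Icc (a i) (a' i), toFun x = slope i * x + c i
  eqId : ∀ x, x ∉ (⋃ i, Set.Icc (a i) (a' i)) → toFun x = x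
  mapsA : ∀ i, Set.MapsTo toFun (Set.Icc (a i) (a' i)) (Set.Icc (a i) (a' i))
  meas : Measurable toFun

lemma jordan_real_sub (μ : SignedMeasure ℝ) {s : Set ℝ} (hs : MeasurableSet s) :
    μ s = μ.toJordanDecomposition.posPart.real s - μ.toJordanDecomposition.negPart.real s := by
  conv_lhs => rw [← SignedMeasure.toSignedMeasure_toJordanDecomposition μ]
  exact Measure.toSignedMeasure_sub_apply hs

lemma ConcOnUnit.ae_posPart {μ : SignedMeasure ℝ} (h : ConcOnUnit μ) :
    ∀ᵐ x ∂μ.toJordanDecomposition.posPart, x ∈ Icc (0 : ℝ) 1 := h.1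

lemma ConcOnUnit.ae_negPart {μ : SignedMeasure ℝ} (h : ConcOnUnit μ) :
    ∀ᵐ x ∂μ.toJordanDecomposition.negPart, x ∈ Icc (0 : ℝ) 1 := h.2

/-- A signed measure vanishing on all measurable subsets of `E` has Jordan parts vanishing
on `E`. -/
lemma jordan_parts_eq_zero (μ : SignedMeasure ℝ) {E : Set ℝ} (hE : MeasurableSet E)
    (h : ∀ s ⊆ E, MeasurableSet s → μ s = 0) :
    μ.toJordanDecomposition.posPart E = 0 ∧ μ.toJordanDecomposition.negPart E = 0 := by
  obtain ⟨S, hS, hpos, hneg⟩ := μ.toJordanDecomposition.mutuallySingular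
  have h1 := h (E ∩ S) inter_subset_left (hE.inter hS)
  have h2 := h (E ∩ Sᶜ) inter_subset_left (hE.inter hS.compl)
  rw [jordan_real_sub μ (hE.inter hS)] at h1
  rw [jordan_real_sub μ (hE.inter hS.compl)] at h2
  have p1 : μ.toJordanDecomposition.posPart (E ∩ S) = 0 := measure_mono_null inter_subset_right hpos
  have n2 : μ.toJordanDecomposition.negPart (E ∩ Sᶜ) = 0 :=
    measure_mono_null inter_subset_right hneg
  have p1' := (measureReal_eq_zero_iff (μ := μ.toJordanDecomposition.posPart) (s := E ∩ S)).2 p1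
  have n2' := (measureReal_eq_zero_iff (μ := μ.toJordanDecomposition.negPart) (s := E ∩ Sᶜ)).2 n2
  have n1 : μ.toJordanDecomposition.negPart (E ∩ S) = 0 := by
    rw [← measureReal_eq_zero_iff]; linarith
  have p2 : μ.toJordanDecomposition.posPart (E ∩ Sᶜ) = 0 := by
    rw [← measureReal_eq_zero_iff]; linarith
  constructor
  · rw [← inter_union_compl E S]; exact measure_union_null p1 p2
  · rw [← inter_union_compl E S]; exact measure_union_null n1 n2

lemma jordan_singleton_eq_zero (μ : SignedMeasure ℝ) {x : ℝ} (h : μ {x} = 0) :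
    μ.toJordanDecomposition.posPart {x} = 0 ∧ μ.toJordanDecomposition.negPart {x} = 0 := by
  refine jordan_parts_eq_zero μ (measurableSet_singleton x) fun s hs _ => ?_
  rcases subset_singleton_iff_eq.1 hs with rfl | rfl
  · exact VectorMeasure.empty _
  · exact h

/-- Functions bounded on `[0,1]` are integrable for finite measures concentrated there. -/
lemma integrable_of_bound_on_unit (m : Measure ℝ) [IsFiniteMeasure m]
    (hm : ∀ᵐ x ∂m, x ∈ Icc (0 : ℝ) 1) {f : ℝ → ℝ} (hf : Measurable f) {C : ℝ}
    (hC : ∀ x ∈ Icc (0 : ℝ) 1, |f x| ≤ C) : Integrable f m :=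
  Integrable.of_bound hf.aestronglyMeasurable C (hm.mono fun x hx => by simpa using hC x hx)

lemma concOnUnit_map {μ : SignedMeasure ℝ} (hμ : ConcOnUnit μ) {T : ℝ → ℝ} (hT : Measurable T)
    (hmaps : MapsTo T (Icc 0 1) (Icc 0 1)) : ConcOnUnit (μ.map T) := by
  refine jordan_parts_eq_zero _ measurableSet_Icc.compl fun s hs hsm => ?_
  have hsub : T ⁻¹' s ⊆ (Icc (0 : ℝ) 1)ᶜ := fun x hx hx' => hs hx (hmaps hx')
  rw [VectorMeasure.map_apply _ hT hsm, jordan_real_sub μ (hT hsm), measureReal_def,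
    measureReal_def, measure_mono_null hsub hμ.1, measure_mono_null hsub hμ.2]
  simp

lemma sInt_map {μ : SignedMeasure ℝ} (hμ : ConcOnUnit μ) {T : ℝ → ℝ} (hT : Measurable T)
    (hmaps : MapsTo T (Icc 0 1) (Icc 0 1)) {f : ℝ → ℝ} (hf : Measurable f) {C : ℝ}
    (hC : ∀ x ∈ Icc (0 : ℝ) 1, |f x| ≤ C) :
    sInt (μ.map T) f = sInt μ (f ∘ T) := by
  have hν := concOnUnit_map hμ hT hmaps
  set p := μ.toJordanDecomposition.posPart
  set q := μ.toJordanDecomposition.negPart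
  set p' := (SignedMeasure.toJordanDecomposition (μ.map T)).posPart
  set q' := (SignedMeasure.toJordanDecomposition (μ.map T)).negPart
  have key : p' + q.map T = q' + p.map T := by
    ext s hs
    rw [Measure.add_apply, Measure.add_apply, ← ENNReal.toReal_eq_toReal_iff' (by finiteness)
      (by finiteness), ENNReal.toReal_add (by finiteness) (by finiteness),
      ENNReal.toReal_add (by finiteness) (by finiteness), Measure.map_apply hT hs,
      Measure.map_apply hT hs]
    have h1 := jordan_real_sub (μ.map T) hs
    rw [VectorMeasure.map_apply _ hT hs, jordan_real_sub μ (hT hs)] at h1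
    simp only [measureReal_def] at h1
    linarith
  have hap : ∀ᵐ x ∂(p.map T), x ∈ Icc (0 : ℝ) 1 :=
    (ae_map_iff hT.aemeasurable measurableSet_Icc).2 (hμ.ae_posPart.mono fun x hx => hmaps hx)
  have haq : ∀ᵐ x ∂(q.map T), x ∈ Icc (0 : ℝ) 1 :=
    (ae_map_iff hT.aemeasurable measurableSet_Icc).2 (hμ.ae_negPart.mono fun x hx => hmaps hx)
  have h := congrArg (fun m => ∫ x, f x ∂m) key

  rw [integral_add_measure (integrable_of_bound_on_unit p' hν.ae_posPart hf hC)
      (integrable_of_bound_on_unit _ haq hf hC),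
    integral_add_measure (integrable_of_bound_on_unit q' hν.ae_negPart hf hC)
      (integrable_of_bound_on_unit _ hap hf hC),
    integral_map hT.aemeasurable hf.aestronglyMeasurable,
    integral_map hT.aemeasurable hf.aestronglyMeasurable] at h
  simp only [sInt, Function.comp_def]
  linarith

lemma ae_notMem_finite {μ : SignedMeasure ℝ} {Z : Set ℝ} (hZ : Z.Finite)
    (hatom : ∀ z ∈ Z, μ {z} = 0) :
    (∀ᵐ x ∂μ.toJordanDecomposition.posPart, x ∉ Z) ∧
      ∀ᵐ x ∂μ.toJordanDecomposition.negPart, x ∉ Z := by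
  constructor <;> refine measure_eq_zero_iff_ae_notMem.1 ?_ <;>
    rw [← biUnion_of_singleton Z, measure_biUnion_null_iff hZ.countable]
  · exact fun z hz => (jordan_singleton_eq_zero μ (hatom z hz)).1
  · exact fun z hz => (jordan_singleton_eq_zero μ (hatom z hz)).2

/-- The integral only depends on the integrand on `[0,1]` off a finite set without atoms. -/
lemma sInt_congr_off_finite {μ : SignedMeasure ℝ} (hμ : ConcOnUnit μ) {Z : Set ℝ}
    (hZ : Z.Finite) (hatom : ∀ z ∈ Z, μ {z} = 0) {f g : ℝ → ℝ}
    (h : ∀ x ∈ Icc (0 : ℝ) 1, x ∉ Z → f x = g x) : sInt μ f = sInt μ g := by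
  obtain ⟨hp, hq⟩ := ae_notMem_finite hZ hatom
  unfold sInt
  congr 1
  · exact integral_congr_ae (by filter_upwards [hμ.ae_posPart, hp] with x h1 h2 using h x h1 h2)
  · exact integral_congr_ae (by filter_upwards [hμ.ae_negPart, hq] with x h1 h2 using h x h1 h2)

lemma sInt_tendsto {μ : SignedMeasure ℝ} {F : ℕ → ℝ → ℝ} {f : ℝ → ℝ} {C : ℝ}
    (hF : ∀ k, Measurable (F k)) (hC : ∀ k x, |F k x| ≤ C)
    (hp : ∀ᵐ x ∂μ.toJordanDecomposition.posPart,
      Filter.Tendsto (fun k => F k x) Filter.atTop (nhds (f x)))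
    (hq : ∀ᵐ x ∂μ.toJordanDecomposition.negPart,
      Filter.Tendsto (fun k => F k x) Filter.atTop (nhds (f x))) :
    Filter.Tendsto (fun k => sInt μ (F k)) Filter.atTop (nhds (sInt μ f)) := by
  refine Filter.Tendsto.sub ?_ ?_
  · exact tendsto_integral_of_dominated_convergence (fun _ => C)
      (fun k => (hF k).aestronglyMeasurable) (integrable_const C)
      (fun k => Filter.Eventually.of_forall (hC k)) hp
  · exact tendsto_integral_of_dominated_convergence (fun _ => C)
      (fun k => (hF k).aestronglyMeasurable) (integrable_const C)
      (fun k => Filter.Eventually.of_forall (hC k)) hq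

lemma sInt_const_mul (μ : SignedMeasure ℝ) (c : ℝ) (f : ℝ → ℝ) :
    sInt μ (fun x => c * f x) = c * sInt μ f := by
  simp only [sInt, integral_const_mul, mul_sub]

/-- `V` dominates `∫ φ' dμ` for every test function `φ` of the variation. -/
def VariationBound (μ : SignedMeasure ℝ) (V : ℝ) : Prop :=
  ∀ φ : ℝ → ℝ, ContDiff ℝ 1 φ → (∀ x ∈ Icc (0 : ℝ) 1, |φ x| ≤ 1) → sInt μ (deriv φ) ≤ V

lemma VariationBound.nonneg {μ : SignedMeasure ℝ} {V : ℝ} (h : VariationBound μ V) : 0 ≤ V := by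
  simpa [sInt] using h (fun _ => 0) contDiff_const (by simp)

lemma VariationBound.scale {μ : SignedMeasure ℝ} {V K : ℝ} (h : VariationBound μ V) (hK : 0 < K)
    {φ : ℝ → ℝ} (hφ : ContDiff ℝ 1 φ) (hb : ∀ x ∈ Icc (0 : ℝ) 1, |φ x| ≤ K) :
    sInt μ (deriv φ) ≤ K * V := by
  have h1 := h (fun x => K⁻¹ * φ x) (contDiff_const.mul hφ) (fun x hx => by
    rw [abs_mul, abs_of_pos (inv_pos.2 hK), inv_mul_le_iff₀ hK, mul_one]; exact hb x hx)
  have h2 : deriv (fun x => K⁻¹ * φ x) = fun x => K⁻¹ * deriv φ x := by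
    ext x; exact deriv_const_mul _ (hφ.differentiable one_ne_zero x)
  rw [h2, sInt_const_mul, inv_mul_le_iff₀ hK] at h1
  exact h1

/-- A signed measure of finite variation has no atoms. -/
lemma VariationBound.singleton_eq_zero {μ : SignedMeasure ℝ} {V : ℝ} (h : VariationBound μ V)
    (x : ℝ) : μ {x} = 0 := by
  have hcd : ∀ k : ℕ, ContDiff ℝ 1 (fun t => Real.arctan (k * (t - x))) := fun k =>
    Real.contDiff_arctan.comp (by fun_prop)
  have hder : ∀ k : ℕ, deriv (fun t => Real.arctan (k * (t - x))) =
      fun t => (k : ℝ) * (1 + (k * (t - x)) ^ 2)⁻¹ := fun k => by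
    ext t
    have h1 : HasDerivAt (fun t : ℝ => (k : ℝ) * (t - x)) (k * 1) t :=
      ((hasDerivAt_id t).sub_const x).const_mul _
    rw [h1.arctan.deriv]; ring
  have hbd : ∀ y : ℝ, |Real.arctan y| ≤ 2 := fun y => by
    have := Real.arctan_lt_pi_div_two y
    have := Real.neg_pi_div_two_lt_arctan y
    have := Real.pi_lt_four
    rw [abs_le]; constructor <;> linarith
  set I : ℕ → ℝ := fun k => sInt μ (fun t => (1 + ((k : ℝ) * (t - x)) ^ 2)⁻¹) with hI
  have hup : ∀ k : ℕ, (k : ℝ) * I k ≤ 2 * V := fun k => by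
    have := h.scale two_pos (hcd k) (fun t _ => hbd _)
    rwa [hder, sInt_const_mul] at this
  have hlow : ∀ k : ℕ, -((k : ℝ) * I k) ≤ 2 * V := fun k => by
    have := h.scale two_pos (hcd k).neg (fun t _ => by rw [abs_neg]; exact hbd _)
    rw [deriv.fun_neg', hder] at this
    have h2 := sInt_const_mul μ (-(k : ℝ)) (fun t => (1 + ((k : ℝ) * (t - x)) ^ 2)⁻¹)
    simp only [neg_mul] at h2
    rwa [h2] at this
  have hlim : Filter.Tendsto I Filter.atTop (nhds (sInt μ (indicator {x} 1))) := by
    have hpt : ∀ t : ℝ, Filter.Tendsto (fun k : ℕ => (1 + ((k : ℝ) * (t - x)) ^ 2)⁻¹)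
        Filter.atTop (nhds (indicator {x} (1 : ℝ → ℝ) t)) := fun t => by
      by_cases ht : t = x
      · subst ht; simp
      · rw [indicator_of_notMem (by simpa using ht)]
        refine Filter.Tendsto.inv_tendsto_atTop (Filter.tendsto_atTop_add_const_left _ _ ?_)
        simp only [mul_pow]
        refine Filter.Tendsto.atTop_mul_const (by have := sub_ne_zero.2 ht; positivity) ?_
        exact (Filter.tendsto_pow_atTop two_ne_zero).comp tendsto_natCast_atTop_atTop
    refine sInt_tendsto (C := 1) (fun k => by fun_prop) (fun k t => ?_)
      (Filter.Eventually.of_forall hpt) (Filter.Eventually.of_forall hpt)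
    rw [abs_of_nonneg (by positivity)]
    exact inv_le_one_of_one_le₀ (by nlinarith [sq_nonneg ((k : ℝ) * (t - x))])
  have hz : Filter.Tendsto I Filter.atTop (nhds 0) := by
    refine squeeze_zero_norm' (a := fun k : ℕ => 2 * V / k) ?_
      (tendsto_const_div_atTop_nhds_zero_nat _)
    filter_upwards [Filter.eventually_gt_atTop 0] with k hk
    have hk' : (0 : ℝ) < k := by exact_mod_cast hk
    rw [Real.norm_eq_abs, le_div_iff₀ hk', ← abs_of_pos hk', ← abs_mul, mul_comm, abs_le]
    exact ⟨by linarith [hlow k], hup k⟩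
  have := tendsto_nhds_unique hlim hz
  rw [jordan_real_sub μ (measurableSet_singleton x)]
  rwa [sInt, integral_indicator_one (measurableSet_singleton x),
    integral_indicator_one (measurableSet_singleton x)] at this

/-- Lipschitz functions that are differentiable off a finite set are admissible test functions,
by approximation with Steklov averages. -/
lemma VariationBound.le_of_lipschitz {μ : SignedMeasure ℝ} {V : ℝ} (h : VariationBound μ V)
    (hμ : ConcOnUnit μ) {G g : ℝ → ℝ} {L K : ℝ} (hK : 0 < K)
    (hL : ∀ x y, |G x - G y| ≤ L * |x - y|) (hb : ∀ x, |G x| ≤ K) {Z : Set ℝ} (hZ : Z.Finite)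
    (hd : ∀ x ∈ Icc (0 : ℝ) 1, x ∉ Z → HasDerivAt G (g x) x) : sInt μ g ≤ K * V := by
  have hcont : Continuous G :=
    (LipschitzWith.of_dist_le' (K := L) fun x y => by
      simpa [Real.dist_eq] using hL x y).continuous
  set F : ℝ → ℝ := fun x => ∫ t in (0 : ℝ)..x, G t with hF
  have hFd : ∀ x, HasDerivAt F (G x) x := fun x => (hcont.integral_hasStrictDerivAt 0 x).hasDerivAt
  set N : ℕ → ℝ := fun k => (k : ℝ) + 1 with hN
  have hNpos : ∀ k, 0 < N k := fun k => by positivity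
  set S : ℕ → ℝ → ℝ := fun k x => N k * (F (x + (N k)⁻¹) - F x) with hS
  set D : ℕ → ℝ → ℝ := fun k x => N k * (G (x + (N k)⁻¹) - G x) with hD
  have hSd : ∀ k x, HasDerivAt (S k) (D k x) x := fun k x =>
    (((hFd (x + (N k)⁻¹)).comp_add_const x _).sub (hFd x)).const_mul _
  have hDS : ∀ k, deriv (S k) = D k := fun k => funext fun x => (hSd k x).deriv
  have hDcont : ∀ k, Continuous (D k) := fun k => by fun_prop
  have hScd : ∀ k, ContDiff ℝ 1 (S k) := fun k =>
    contDiff_one_iff_deriv.2 ⟨fun x => (hSd k x).differentiableAt, by rw [hDS]; exact hDcont k⟩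
  have hSb : ∀ k x, |S k x| ≤ K := fun k x => by
    have h1 : F (x + (N k)⁻¹) - F x = ∫ t in x..(x + (N k)⁻¹), G t :=
      intervalIntegral.integral_interval_sub_left (hcont.intervalIntegrable _ _)
        (hcont.intervalIntegrable _ _)
    have h2 := intervalIntegral.norm_integral_le_of_norm_le_const (a := x) (b := x + (N k)⁻¹)
      (f := G) (C := K) fun t _ => hb t
    rw [add_sub_cancel_left, abs_of_pos (inv_pos.2 (hNpos k)), Real.norm_eq_abs,
      ← div_eq_mul_inv, le_div_iff₀ (hNpos k)] at h2
    rw [hS]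
    simp only
    rw [h1, abs_mul, abs_of_pos (hNpos k), mul_comm]
    exact h2
  have hDb : ∀ k x, |D k x| ≤ L := fun k x => by
    have h1 := hL (x + (N k)⁻¹) x
    rw [add_sub_cancel_left, abs_of_pos (inv_pos.2 (hNpos k)), ← div_eq_mul_inv,
      le_div_iff₀ (hNpos k)] at h1
    rw [hD]
    simp only
    rw [abs_mul, abs_of_pos (hNpos k), mul_comm]
    exact h1
  have hNlim : Filter.Tendsto (fun k => (N k)⁻¹) Filter.atTop (nhdsWithin 0 {0}ᶜ) := by
    refine tendsto_nhdsWithin_iff.2 ⟨?_, Filter.Eventually.of_forall fun k =>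
      (inv_pos.2 (hNpos k)).ne'⟩
    simpa [hN] using tendsto_one_div_add_atTop_nhds_zero_nat (𝕜 := ℝ)
  have hpt : ∀ x ∈ Icc (0 : ℝ) 1, x ∉ Z →
      Filter.Tendsto (fun k => D k x) Filter.atTop (nhds (g x)) := fun x hx hxZ => by
    simpa [Function.comp_def, hD] using
      (hasDerivAt_iff_tendsto_slope_zero.1 (hd x hx hxZ)).comp hNlim
  have hae := ae_notMem_finite (μ := μ) hZ fun z _ => h.singleton_eq_zero z
  have hlim : Filter.Tendsto (fun k => sInt μ (D k)) Filter.atTop (nhds (sInt μ g)) :=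
    sInt_tendsto (fun k => (hDcont k).measurable) hDb
      (by filter_upwards [hμ.ae_posPart, hae.1] with x h1 h2 using hpt x h1 h2)
      (by filter_upwards [hμ.ae_negPart, hae.2] with x h1 h2 using hpt x h1 h2)
  refine le_of_tendsto' hlim fun k => ?_
  rw [← hDS]
  exact h.scale hK (hScd k) fun x _ => hSb k x

/-- The retraction of `ℝ` onto `[u, v]`. -/
noncomputable def clampTo (u v x : ℝ) : ℝ := max u (min v x)

lemma clampTo_mem {u v : ℝ} (h : u ≤ v) (x : ℝ) : clampTo u v x ∈ Icc u v :=
  ⟨le_max_left _ _, max_le h (min_le_left _ _)⟩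

lemma abs_clampTo_sub_le (u v x y : ℝ) : |clampTo u v x - clampTo u v y| ≤ |x - y| := by
  refine (abs_max_sub_max_le_max u _ u _).trans ?_
  simpa using abs_min_sub_min_le_max v x v y

open Classical in
lemma hasDerivAt_comp_clampTo {u v x e : ℝ} {f : ℝ → ℝ} (hu : x ≠ u) (hv : x ≠ v)
    (hf : HasDerivAt f e x) :
    HasDerivAt (fun y => f (clampTo u v y)) (if x ∈ Icc u v then e else 0) x := by
  split_ifs with hx
  · refine hf.congr_of_eventuallyEq ?_
    filter_upwards [Ioo_mem_nhds (lt_of_le_of_ne hx.1 hu.symm) (lt_of_le_of_ne hx.2 hv)] with y hy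
    rw [clampTo, min_eq_right hy.2.le, max_eq_right hy.1.le]
  · rcases lt_or_gt_of_ne hu with h1 | h1
    · refine (hasDerivAt_const x (f u)).congr_of_eventuallyEq ?_
      filter_upwards [Iio_mem_nhds h1] with y hy
      rw [clampTo, max_eq_left ((min_le_right _ _).trans (le_of_lt hy))]
    · have h2 : v < x := by
        by_contra hc
        exact hx ⟨h1.le, not_lt.1 hc⟩
      refine (hasDerivAt_const x (f (max u v))).congr_of_eventuallyEq ?_
      filter_upwards [Ioi_mem_nhds h2] with y hy
      rw [clampTo, min_eq_left (le_of_lt hy)]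

open Classical in
/-- The function equal to `φ'(s_i x + d_i)` on `[u_i, v_i]`, to `0` on the rest of `[a_i, b_i]` and
to `φ'` elsewhere, up to finitely many points. -/
noncomputable def patchedDeriv {n : ℕ} (φ : ℝ → ℝ) (a b u v s d : Fin n → ℝ) (x : ℝ) : ℝ :=
  deriv φ x + ∑ i, ((if x ∈ Icc (u i) (v i) then deriv φ (s i * x + d i) else 0) -
    if x ∈ Icc (a i) (b i) then deriv φ x else 0)

/-- The finite set of exceptional points of `patchedDeriv`. -/
def breakpoints {n : ℕ} (a b u v : Fin n → ℝ) : Set ℝ :=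
  {0, 1} ∪ (range a ∪ range b ∪ (range u ∪ range v))

lemma finite_breakpoints {n : ℕ} (a b u v : Fin n → ℝ) : (breakpoints a b u v).Finite :=
  (toFinite _).union (((finite_range a).union (finite_range b)).union
    ((finite_range u).union (finite_range v)))

lemma VariationBound.patchedDeriv_le {n : ℕ} {μ : SignedMeasure ℝ} {V : ℝ}
    (h : VariationBound μ V) (hμ : ConcOnUnit μ) {φ : ℝ → ℝ} (hφ : ContDiff ℝ 1 φ)
    (hφb : ∀ x ∈ Icc (0 : ℝ) 1, |φ x| ≤ 1) {a b u v s d : Fin n → ℝ}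
    (hab : ∀ i, a i ≤ b i) (huv : ∀ i, u i ≤ v i) (ha : ∀ i, 0 ≤ a i) (hb : ∀ i, b i ≤ 1)
    (hs : ∀ i, 0 < s i)
    (hmaps : ∀ i, ∀ x ∈ Icc (u i) (v i), s i * x + d i ∈ Icc (0 : ℝ) 1) :
    sInt μ (patchedDeriv φ a b u v s d) ≤ ((n : ℝ) + 1 + ∑ i, (s i)⁻¹) * V := by
  obtain ⟨L, hLφ⟩ := hφ.contDiffOn.exists_lipschitzOnWith one_ne_zero (convex_Icc (0 : ℝ) 1)
    isCompact_Icc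
  have hL : ∀ x ∈ Icc (0 : ℝ) 1, ∀ y ∈ Icc (0 : ℝ) 1, |φ x - φ y| ≤ L * |x - y| := by
    simpa [Real.dist_eq] using hLφ.dist_le_mul
  have hmem : ∀ i x, clampTo (a i) (b i) x ∈ Icc (0 : ℝ) 1 := fun i x =>
    Icc_subset_Icc (ha i) (hb i) (clampTo_mem (hab i) x)
  have hmem' : ∀ i x, s i * clampTo (u i) (v i) x + d i ∈ Icc (0 : ℝ) 1 := fun i x =>
    hmaps i _ (clampTo_mem (huv i) x)
  have hmem0 : ∀ x, clampTo 0 1 x ∈ Icc (0 : ℝ) 1 := clampTo_mem zero_le_one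
  set G : ℝ → ℝ := fun x => φ (clampTo 0 1 x) +
    ∑ i, ((s i)⁻¹ * φ (s i * clampTo (u i) (v i) x + d i) - φ (clampTo (a i) (b i) x)) with hG
  have hsum0 : 0 ≤ ∑ i, (s i)⁻¹ := Finset.sum_nonneg fun i _ => (inv_pos.2 (hs i)).le
  refine h.le_of_lipschitz hμ (G := G) (L := L + ∑ _i : Fin n, ((L : ℝ) + L)) (by positivity) ?_ ?_
    (finite_breakpoints a b u v) ?_
  · intro x y
    have h0 : |φ (clampTo 0 1 x) - φ (clampTo 0 1 y)| ≤ L * |x - y| :=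
      (hL _ (hmem0 x) _ (hmem0 y)).trans
        (mul_le_mul_of_nonneg_left (abs_clampTo_sub_le _ _ _ _) L.2)
    have hi : ∀ i, |((s i)⁻¹ * φ (s i * clampTo (u i) (v i) x + d i) - φ (clampTo (a i) (b i) x)) -
        ((s i)⁻¹ * φ (s i * clampTo (u i) (v i) y + d i) - φ (clampTo (a i) (b i) y))| ≤
        (L + L) * |x - y| := fun i => by
      have h1 := (hL _ (hmem' i x) _ (hmem' i y))
      rw [add_sub_add_right_eq_sub, ← mul_sub, abs_mul, abs_of_pos (hs i)] at h1
      have h2 : |(s i)⁻¹ * (φ (s i * clampTo (u i) (v i) x + d i) -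
          φ (s i * clampTo (u i) (v i) y + d i))| ≤ L * |x - y| := by
        rw [abs_mul, abs_of_pos (inv_pos.2 (hs i)), inv_mul_le_iff₀ (hs i)]
        refine h1.trans ?_
        rw [mul_left_comm]
        exact mul_le_mul_of_nonneg_left
          (mul_le_mul_of_nonneg_left (abs_clampTo_sub_le _ _ _ _) L.2) (hs i).le
      have h3 : |φ (clampTo (a i) (b i) x) - φ (clampTo (a i) (b i) y)| ≤ L * |x - y| :=
        (hL _ (hmem i x) _ (hmem i y)).trans
        (mul_le_mul_of_nonneg_left (abs_clampTo_sub_le _ _ _ _) L.2)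
      rw [show ∀ p q r t w : ℝ, (p * q - r) - (p * t - w) = p * (q - t) - (r - w) by
        intros; ring, add_mul]
      exact (abs_sub _ _).trans (add_le_add h2 h3)
    simp only [hG]
    rw [add_sub_add_comm, ← Finset.sum_sub_distrib, add_mul, Finset.sum_mul]
    exact (abs_add_le _ _).trans (add_le_add h0
      ((Finset.abs_sum_le_sum_abs _ _).trans (Finset.sum_le_sum fun i _ => hi i)))
  · intro x
    have hi : ∀ i, |(s i)⁻¹ * φ (s i * clampTo (u i) (v i) x + d i) - φ (clampTo (a i) (b i) x)| ≤
        (s i)⁻¹ + 1 := fun i => by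
      refine (abs_sub _ _).trans (add_le_add ?_ (hφb _ (hmem i x)))
      rw [abs_mul, abs_of_pos (inv_pos.2 (hs i))]
      exact mul_le_of_le_one_right (inv_pos.2 (hs i)).le (hφb _ (hmem' i x))
    have := (abs_add_le _ _).trans (add_le_add (hφb _ (hmem0 x))
      ((Finset.abs_sum_le_sum_abs _ _).trans
        (Finset.sum_le_sum fun i (_ : i ∈ Finset.univ) => hi i)))
    rw [Finset.sum_add_distrib] at this
    simp only [Finset.sum_const, Finset.card_univ, Fintype.card_fin, nsmul_eq_mul, mul_one] at this
    simp only [hG]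
    linarith
  · intro x hx hxZ
    simp only [breakpoints, mem_union, mem_insert_iff, mem_singleton_iff, mem_range, not_or,
      not_exists] at hxZ
    obtain ⟨⟨hx0, hx1⟩, ⟨hxa, hxb⟩, hxu, hxv⟩ := hxZ
    have hφd : ∀ y, HasDerivAt φ (deriv φ y) y := fun y =>
      (hφ.differentiable one_ne_zero y).hasDerivAt
    have h0 := hasDerivAt_comp_clampTo hx0 hx1 (hφd x)
    rw [if_pos hx] at h0
    refine h0.add (HasDerivAt.fun_sum fun i _ => HasDerivAt.sub ?_ ?_)
    · refine hasDerivAt_comp_clampTo (f := fun y => (s i)⁻¹ * φ (s i * y + d i))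
        (fun e => hxu i e.symm) (fun e => hxv i e.symm) ?_
      have h1 : HasDerivAt (fun y => s i * y + d i) (s i) x := by
        simpa using ((hasDerivAt_id x).const_mul (s i)).add_const (d i)
      have h2 := ((hφd (s i * x + d i)).comp x h1).const_mul (s i)⁻¹
      rwa [mul_comm (deriv φ _), inv_mul_cancel_left₀ (hs i).ne'] at h2
    · exact hasDerivAt_comp_clampTo (fun e => hxa i e.symm) (fun e => hxb i e.symm) (hφd x)

section patchedDeriv

variable {n : ℕ} {φ : ℝ → ℝ} {a b u v s d : Fin n → ℝ} {x : ℝ}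

lemma patchedDeriv_of_notMem (hsub : ∀ i, Icc (u i) (v i) ⊆ Icc (a i) (b i))
    (h : ∀ i, x ∉ Icc (a i) (b i)) : patchedDeriv φ a b u v s d x = deriv φ x := by
  rw [patchedDeriv, Finset.sum_eq_zero, add_zero]
  intro i _
  rw [if_neg fun hx => h i (hsub i hx), if_neg (h i), sub_zero]

lemma patchedDeriv_of_mem (hsub : ∀ i, Icc (u i) (v i) ⊆ Icc (a i) (b i)) {j : Fin n}
    (h : ∀ i, i ≠ j → x ∉ Icc (a i) (b i)) (hx : x ∈ Icc (u j) (v j)) :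
    patchedDeriv φ a b u v s d x = deriv φ (s j * x + d j) := by
  rw [patchedDeriv, Finset.sum_eq_single j, if_pos hx, if_pos (hsub j hx)]
  · ring
  · intro i _ hij
    rw [if_neg fun hx => h i hij (hsub i hx), if_neg (h i hij), sub_zero]
  · simp

lemma measurable_patchedDeriv (hφ : ContDiff ℝ 1 φ) :
    Measurable (patchedDeriv φ a b u v s d) := by
  have hm : Measurable (deriv φ) := (contDiff_one_iff_deriv.1 hφ).2.measurable
  refine hm.add (Finset.measurable_fun_sum _ fun i _ => ?_)
  exact (Measurable.ite measurableSet_Icc (by fun_prop) measurable_const).sub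
    (Measurable.ite measurableSet_Icc hm measurable_const)

lemma exists_deriv_bound (hφ : ContDiff ℝ 1 φ) :
    ∃ C, ∀ x ∈ Icc (0 : ℝ) 1, |deriv φ x| ≤ C :=
  isCompact_Icc.exists_bound_of_continuousOn (contDiff_one_iff_deriv.1 hφ).2.continuousOn

lemma exists_patchedDeriv_bound (hφ : ContDiff ℝ 1 φ)
    (hmaps : ∀ i, ∀ x ∈ Icc (u i) (v i), s i * x + d i ∈ Icc (0 : ℝ) 1) :
    ∃ C, ∀ x ∈ Icc (0 : ℝ) 1, |patchedDeriv φ a b u v s d x| ≤ C := by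
  obtain ⟨C, hC⟩ := exists_deriv_bound hφ
  have hC0 : 0 ≤ C := (abs_nonneg _).trans (hC 0 (by simp))
  refine ⟨C + ∑ _i : Fin n, (C + C), fun x hx => ?_⟩
  refine (abs_add_le _ _).trans (add_le_add (hC x hx)
    ((Finset.abs_sum_le_sum_abs _ _).trans (Finset.sum_le_sum fun i _ =>
      (abs_sub _ _).trans (add_le_add ?_ ?_))))
  · split_ifs with h
    · exact hC _ (hmaps i x h)
    · simpa using hC0
  · split_ifs
    · exact hC x hx
    · simpa using hC0

end patchedDeriv

namespace PiecewiseLinearMap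

variable {n : ℕ} (P : PiecewiseLinearMap n)

lemma right_le_left {i j : Fin n} (hij : i < j) : P.a' i ≤ P.a j := by
  obtain ⟨j, hj⟩ := j
  induction j with
  | zero => exact absurd hij (by simp [Fin.lt_def])
  | succ k ih =>
    have hk : k < n := by omega
    have hstep := P.hsep ⟨k, hk⟩ hj
    rcases (Nat.lt_succ_iff.1 hij).lt_or_eq with h | h
    · exact ((ih hk h).trans (P.hlt _).le).trans hstep
    · have : i = ⟨k, hk⟩ := Fin.ext h
      rw [this]; exact hstep

lemma eq_endpoint {i j : Fin n} (hij : i < j) {x : ℝ} (hi : x ∈ Icc (P.a i) (P.a' i))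
    (hj : x ∈ Icc (P.a j) (P.a' j)) : x = P.a' i ∧ P.a j = P.a' i := by
  have := P.right_le_left hij
  exact ⟨le_antisymm hi.2 (this.trans hj.1), le_antisymm (hj.1.trans hi.2) this⟩

lemma notMem_of_ne {i j : Fin n} (hij : i ≠ j) {x : ℝ} (hj : x ∈ Icc (P.a j) (P.a' j))
    (hx : ∀ k, x ≠ P.a' k) : x ∉ Icc (P.a i) (P.a' i) := fun hi => by
  rcases lt_or_gt_of_ne hij with h | h
  · exact hx i (P.eq_endpoint h hi hj).1
  · exact hx j (P.eq_endpoint h hj hi).1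

lemma mapsTo_unit : MapsTo P.toFun (Icc 0 1) (Icc 0 1) := fun x hx => by
  by_cases h : x ∈ ⋃ i, Icc (P.a i) (P.a' i)
  · obtain ⟨i, hi⟩ := mem_iUnion.1 h
    exact Icc_subset_Icc (P.ha0 i) (P.ha1 i) (P.mapsA i hi)
  · rwa [P.eqId x h]

lemma injOn_piece (i : Fin n) : InjOn P.toFun (Icc (P.a i) (P.a' i)) := fun x hx y hy h => by
  rw [P.eqA i x hx, P.eqA i y hy] at h
  exact mul_left_cancel₀ (P.slope_pos i).ne' (add_right_cancel h)

lemma eq_of_mem_of_lt {i j : Fin n} (hij : i < j) {x y : ℝ} (hx : x ∈ Icc (P.a i) (P.a' i))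
    (hy : y ∈ Icc (P.a j) (P.a' j)) (h : P.toFun x = P.toFun y) : x = y := by
  have h1 := P.mapsA i hx
  have h2 := P.mapsA j hy
  rw [← h] at h2
  obtain ⟨e1, e2⟩ := P.eq_endpoint hij h1 h2
  have m1 : P.a' i ∈ Icc (P.a i) (P.a' i) := right_mem_Icc.2 (P.hlt i).le
  have m2 : P.a' i ∈ Icc (P.a j) (P.a' j) := e2 ▸ left_mem_Icc.2 (P.hlt j).le
  have e3 := (P.eq_endpoint hij (P.mapsA i m1) (P.mapsA j m2)).1
  rw [P.injOn_piece i hx m1 (e1.trans e3.symm),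
    P.injOn_piece j hy m2 ((h.symm.trans e1).trans e3.symm)]

lemma injective : Function.Injective P.toFun := fun x y h => by
  by_cases hx : x ∈ ⋃ i, Icc (P.a i) (P.a' i) <;> by_cases hy : y ∈ ⋃ i, Icc (P.a i) (P.a' i)
  · obtain ⟨i, hi⟩ := mem_iUnion.1 hx
    obtain ⟨j, hj⟩ := mem_iUnion.1 hy
    rcases lt_trichotomy i j with hij | rfl | hij
    · exact P.eq_of_mem_of_lt hij hi hj h
    · exact P.injOn_piece i hi hj h
    · exact (P.eq_of_mem_of_lt hij hj hi h.symm).symm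
  · obtain ⟨i, hi⟩ := mem_iUnion.1 hx
    rw [P.eqId y hy] at h
    exact absurd (mem_iUnion.2 ⟨i, h ▸ P.mapsA i hi⟩) hy
  · obtain ⟨i, hi⟩ := mem_iUnion.1 hy
    rw [P.eqId x hx] at h
    exact absurd (mem_iUnion.2 ⟨i, h ▸ P.mapsA i hi⟩) hx
  · rwa [P.eqId x hx, P.eqId y hy] at h

variable {P} {μ : SignedMeasure ℝ} {V : ℝ}

lemma variationBound_map (hμ : ConcOnUnit μ) (h : VariationBound μ V) :
    VariationBound (μ.map P.toFun) (((n : ℝ) + 1 + ∑ i, (P.slope i)⁻¹) * V) := by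
  intro φ hφ hφb
  obtain ⟨C, hC⟩ := exists_deriv_bound hφ
  rw [sInt_map hμ P.meas P.mapsTo_unit (contDiff_one_iff_deriv.1 hφ).2.measurable hC]
  have hpatch : sInt μ (deriv φ ∘ P.toFun) =
      sInt μ (patchedDeriv φ P.a P.a' P.a P.a' P.slope P.c) := by
    refine sInt_congr_off_finite hμ (finite_range P.a') (fun z _ => h.singleton_eq_zero z)
      fun x _ hxZ => ?_
    by_cases hx : ∃ j, x ∈ Icc (P.a j) (P.a' j)
    · obtain ⟨j, hj⟩ := hx
      rw [patchedDeriv_of_mem (fun _ => Subset.rfl) (fun i hij => P.notMem_of_ne hij hj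
        fun k e => hxZ ⟨k, e.symm⟩) hj, Function.comp_apply, P.eqA j x hj]
    · rw [patchedDeriv_of_notMem (fun _ => Subset.rfl) (not_exists.1 hx), Function.comp_apply,
        P.eqId x (by simpa using hx)]
  rw [hpatch]
  refine h.patchedDeriv_le hμ hφ hφb (fun i => (P.hlt i).le) (fun i => (P.hlt i).le) P.ha0 P.ha1
    P.slope_pos fun i x hx => ?_
  rw [← P.eqA i x hx]
  exact Icc_subset_Icc (P.ha0 i) (P.ha1 i) (P.mapsA i hx)

/-- As `P` is injective with piecewise affine inverse, `μ` has finite variation as soon as its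
image under `P` does. -/
lemma variationBound_of_map (hμ : ConcOnUnit μ) (h : VariationBound (μ.map P.toFun) V) :
    VariationBound μ (((n : ℝ) + 1 + ∑ i, ((P.slope i)⁻¹)⁻¹) * V) := by
  intro φ hφ hφb
  set u : Fin n → ℝ := fun i => P.slope i * P.a i + P.c i with hu
  set v : Fin n → ℝ := fun i => P.slope i * P.a' i + P.c i with hv
  set d : Fin n → ℝ := fun i => -((P.slope i)⁻¹ * P.c i) with hd
  set s : Fin n → ℝ := fun i => (P.slope i)⁻¹ with hs
  have huv : ∀ i, u i ≤ v i := fun i => by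
    have := mul_le_mul_of_nonneg_left (P.hlt i).le (P.slope_pos i).le
    simp only [hu, hv]; linarith
  have hua : ∀ i, P.a i ≤ u i := fun i => by
    have := (P.mapsA i (left_mem_Icc.2 (P.hlt i).le)).1
    rwa [P.eqA i _ (left_mem_Icc.2 (P.hlt i).le)] at this
  have hva : ∀ i, v i ≤ P.a' i := fun i => by
    have := (P.mapsA i (right_mem_Icc.2 (P.hlt i).le)).2
    rwa [P.eqA i _ (right_mem_Icc.2 (P.hlt i).le)] at this
  have hsub : ∀ i, Icc (u i) (v i) ⊆ Icc (P.a i) (P.a' i) := fun i =>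
    Icc_subset_Icc (hua i) (hva i)
  have hinv : ∀ i x, s i * (P.slope i * x + P.c i) + d i = x := fun i x => by
    have := (P.slope_pos i).ne'
    simp only [hs, hd]; field_simp; ring
  have hmaps : ∀ i, ∀ y ∈ Icc (u i) (v i), s i * y + d i ∈ Icc (0 : ℝ) 1 := fun i y hy => by
    have hspos : 0 ≤ s i := (inv_pos.2 (P.slope_pos i)).le
    have h1 := mul_le_mul_of_nonneg_left hy.1 hspos
    have h2 := mul_le_mul_of_nonneg_left hy.2 hspos
    have h3 := hinv i (P.a i)
    have h4 := hinv i (P.a' i)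
    have h5 := P.ha0 i
    have h6 := P.ha1 i
    simp only [hu, hv] at h1 h2
    constructor <;> linarith
  have hatom : ∀ x, μ {x} = 0 := fun x => by
    rw [← h.singleton_eq_zero (P.toFun x), VectorMeasure.map_apply _ P.meas
      (measurableSet_singleton _)]
    congr 1
    ext y
    simp [P.injective.eq_iff]
  obtain ⟨C, hC⟩ := exists_patchedDeriv_bound (a := P.a) (b := P.a') hφ hmaps
  have hpatch : sInt μ (deriv φ) = sInt (μ.map P.toFun) (patchedDeriv φ P.a P.a' u v s d) := by
    rw [sInt_map hμ P.meas P.mapsTo_unit (measurable_patchedDeriv hφ) hC]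
    refine sInt_congr_off_finite hμ ((finite_range P.a').preimage P.injective.injOn)
      (fun z _ => hatom z) fun x _ hxZ => ?_
    by_cases hx : ∃ j, x ∈ Icc (P.a j) (P.a' j)
    · obtain ⟨j, hj⟩ := hx
      have hmem : P.toFun x ∈ Icc (u j) (v j) := by
        have h1 := mul_le_mul_of_nonneg_left hj.1 (P.slope_pos j).le
        have h2 := mul_le_mul_of_nonneg_left hj.2 (P.slope_pos j).le
        rw [P.eqA j x hj]
        exact ⟨by simp only [hu]; linarith, by simp only [hv]; linarith⟩
      rw [Function.comp_apply, patchedDeriv_of_mem hsub (fun i hij => P.notMem_of_ne hij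
        (P.mapsA j hj) fun k e => hxZ ⟨k, e.symm⟩) hmem, P.eqA j x hj, hinv]
    · rw [Function.comp_apply, P.eqId x (by simpa using hx),
        patchedDeriv_of_notMem hsub (not_exists.1 hx)]
  rw [hpatch]
  exact h.patchedDeriv_le (concOnUnit_map hμ P.meas P.mapsTo_unit) hφ hφb
    (fun i => (P.hlt i).le) huv P.ha0 P.ha1 (fun i => inv_pos.2 (P.slope_pos i)) hmaps

end PiecewiseLinearMap

lemma VariationBound.Vvar_le {μ : SignedMeasure ℝ} {V : ℝ} (h : VariationBound μ V) :
    Vvar μ ≤ V := by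
  refine csSup_le ⟨_, fun _ => 0, contDiff_const, by simp, rfl⟩ ?_
  rintro y ⟨φ, hφ, hb, rfl⟩
  exact h φ hφ hb

lemma VariationBound.variationBound_Vvar {μ : SignedMeasure ℝ} {V : ℝ} (h : VariationBound μ V) :
    VariationBound μ (Vvar μ) := fun φ hφ hb => by
  refine le_csSup ⟨V, ?_⟩ ⟨φ, hφ, hb, rfl⟩
  rintro y ⟨ψ, hψ, hb', rfl⟩
  exact h ψ hψ hb'

lemma Vvar_eq_zero_of_not_variationBound {μ : SignedMeasure ℝ} (h : ¬ ∃ V, VariationBound μ V) :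
    Vvar μ = 0 := by
  refine Real.sSup_of_not_bddAbove fun ⟨V, hV⟩ => h ⟨V, fun φ hφ hb => hV ⟨φ, hφ, hb, rfl⟩⟩

/-- For the piecewise-linear map `τ` and every finite signed Borel measure `μ` on `[0,1]`:
`V(τ*μ) ≤ (n + 1 + Σ_i 1/α_i)·V(μ)`. -/
theorem variation_transfer_piecewise_linear {n : ℕ} (P : PiecewiseLinearMap n)
    (μ : SignedMeasure ℝ) (hμ : ConcOnUnit μ) :
    Vvar (μ.map P.toFun) ≤ ((n : ℝ) + 1 + ∑ i, (P.slope i)⁻¹) * Vvar μ := by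
  by_cases h : ∃ V, VariationBound μ V
  · obtain ⟨V, hV⟩ := h
    exact (PiecewiseLinearMap.variationBound_map hμ hV.variationBound_Vvar).Vvar_le
  · have hmap : ¬ ∃ V, VariationBound (μ.map P.toFun) V := fun ⟨V, hV⟩ =>
      h ⟨_, PiecewiseLinearMap.variationBound_of_map hμ hV⟩
    rw [Vvar_eq_zero_of_not_variationBound h, Vvar_eq_zero_of_not_variationBound hmap, mul_zero]
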